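/- For every alpha in (0,1], the class DIM^alpha = {X : dim(X) = alpha} is meager in Cantor space, and therefore is not a Pi^0_2 class. -/

import Mathlib

open Filter Topology

abbrev Cantor := ℕ → Bool

/-- The length-`n` prefix of an infinite binary sequence, as a list. -/
def pref (X : ℕ → Bool) (n : ℕ) : List Bool := (List.range n).map X

/-- A predicate is computably enumerable (c.e., Σ⁰₁). -/
def CEPred {α : Type} [Primcodable α] (P : α → Prop) : Prop :=
  ∃ f : α →. Unit, Partrec f ∧ ∀ a, P a ↔ (f a).Dom

/-- A predicate (of the outer quantified numbers together with a finite prefix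
of the sequence) is Δ⁰₁, i.e. computable. -/
def DeltaPred (P : List ℕ → List Bool → Prop) : Prop :=
  ComputablePred fun p : List ℕ × List Bool => P p.1 p.2

/-- A predicate is Π⁰₁, i.e. co-computably enumerable. -/
def PiPred (P : List ℕ → List Bool → Prop) : Prop :=
  CEPred fun p : List ℕ × List Bool => ¬ P p.1 p.2

/-- `AltQ n b P ks A`: `n` alternating quantifiers (starting with `∃` if `b`,
with `∀` otherwise) applied to the predicate `P`, where the innermost
quantified variable is the length of the prefix of `A` handed to `P`, and `ks`
accumulates the previously quantified numbers. -/
def AltQ : ℕ → Bool → (List ℕ → List Bool → Prop) → List ℕ → Cantor → Prop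
  | 0, _, P, ks, _ => P ks []
  | 1, true, P, ks, A => ∃ k, P ks (pref A k)
  | 1, false, P, ks, A => ∀ k, P ks (pref A k)
  | n+2, true, P, ks, A => ∃ k, AltQ (n+1) false P (ks ++ [k]) A
  | n+2, false, P, ks, A => ∀ k, AltQ (n+1) true P (ks ++ [k]) A

/-- `X ∈ Σ⁰ₙ[C]`: definable with `n` alternating quantifiers starting with
`∃`, over some predicate in the class `C`. -/
def SigmaIn (n : ℕ) (C : (List ℕ → List Bool → Prop) → Prop) (X : Set Cantor) : Prop :=
  ∃ P, C P ∧ ∀ A : Cantor, A ∈ X ↔ AltQ n true P [] A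

/-- `X ∈ Π⁰ₙ[C]`: definable with `n` alternating quantifiers starting with
`∀`, over some predicate in the class `C`. -/
def PiIn (n : ℕ) (C : (List ℕ → List Bool → Prop) → Prop) (X : Set Cantor) : Prop :=
  ∃ P, C P ∧ ∀ A : Cantor, A ∈ X ↔ AltQ n false P [] A

/-- A prefix-free machine: a partial computable map from programs (finite
binary strings) to strings, whose domain is an antichain under the prefix
relation. -/
def PFMachine (M : List Bool →. List Bool) : Prop :=
  Partrec M ∧ ∀ p q : List Bool, (M p).Dom → (M q).Dom → p <+: q → p = q

/-- A universal prefix-free machine: a prefix-free machine simulating every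
prefix-free machine with only a constant overhead in program length. -/
def UniversalPF (U : List Bool →. List Bool) : Prop :=
  PFMachine U ∧ ∀ M : List Bool →. List Bool, PFMachine M → ∃ c : ℕ,
    ∀ w p : List Bool, w ∈ M p → ∃ q : List Bool, w ∈ U q ∧ q.length ≤ p.length + c

/-- Prefix-free Kolmogorov complexity with respect to the machine `U`: the
length of a shortest program producing `w`. -/
noncomputable def K (U : List Bool →. List Bool) (w : List Bool) : ℕ :=
  sInf {n : ℕ | ∃ p : List Bool, w ∈ U p ∧ p.length = n}

/-- `dimK U X = liminf_n K(X↾n)/n`, the (Kolmogorov characterization of the)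
constructive dimension of the sequence `X`. -/
noncomputable def dimK (U : List Bool →. List Bool) (X : Cantor) : ℝ :=
  Filter.liminf (fun n : ℕ => (K U (pref X n) : ℝ) / n) Filter.atTop

/-- `DimK U X = limsup_n K(X↾n)/n`, the (Kolmogorov characterization of the)
constructive strong dimension of the sequence `X`. -/
noncomputable def DimK (U : List Bool →. List Bool) (X : Cantor) : ℝ :=
  Filter.limsup (fun n : ℕ => (K U (pref X n) : ℝ) / n) Filter.atTop


/-- rest after the first unary block -/
def rst (p : List Bool) : List Bool := p.drop (p.idxOf false + 1)

/-- The coding machine: `1^i 0 1^k 0 τ` with `|τ| = i*k` outputs `τ 0^(k*k - i*k)`. -/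
def machO (p : List Bool) : Option (List Bool) :=
  if p.idxOf false < p.length ∧ (rst p).idxOf false < (rst p).length ∧
      (rst (rst p)).length = p.idxOf false * (rst p).idxOf false then
    some (rst (rst p) ++ (List.range ((rst p).idxOf false * (rst p).idxOf false
      - p.idxOf false * (rst p).idxOf false)).map (fun _ => false))
  else none

theorem rst_primrec : Primrec rst :=
  Primrec.list_drop.comp (Primrec.succ.comp (Primrec.list_idxOf.comp (Primrec.const false) Primrec.id))
    Primrec.id

theorem machO_primrec : Primrec machO := by
  have hi : Primrec (fun p : List Bool => p.idxOf false) :=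
    Primrec.list_idxOf.comp (Primrec.const false) Primrec.id
  have hk : Primrec (fun p : List Bool => (rst p).idxOf false) := hi.comp rst_primrec
  have hl : Primrec (fun p : List Bool => p.length) := Primrec.list_length
  have hik := Primrec.nat_mul.comp hi hk
  refine Primrec.ite (PrimrecPred.and (Primrec.nat_lt.comp hi hl)
    (PrimrecPred.and (Primrec.nat_lt.comp hk (hl.comp rst_primrec))
      (Primrec.eq.comp (hl.comp (rst_primrec.comp rst_primrec)) hik))) ?_ (Primrec.const none)
  refine Primrec.option_some.comp (Primrec.list_append.comp (rst_primrec.comp rst_primrec) ?_)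
  exact Primrec.list_map (Primrec.list_range.comp
    (Primrec.nat_sub.comp (Primrec.nat_mul.comp hk hk) hik)) (Primrec.const false).to₂

theorem rst_prefix {p q : List Bool} (h : p <+: q) (hp : p.idxOf false < p.length) :
    p.idxOf false = q.idxOf false ∧ rst p <+: rst q ∧ (rst p = rst q → p = q) := by
  obtain ⟨t, rfl⟩ := h
  have hm : false ∈ p := List.idxOf_lt_length_iff.1 hp
  have h1 : (p ++ t).idxOf false = p.idxOf false := List.idxOf_append_of_mem hm
  have h2 : rst (p ++ t) = rst p ++ t := by
    unfold rst; rw [h1, List.drop_append_of_le_length (by omega)]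
  refine ⟨h1.symm, ?_, ?_⟩
  · rw [h2]; exact List.prefix_append _ _
  · rw [h2]; intro h
    have : t = [] := by simpa using h
    simp [this]

theorem machO_pf : PFMachine (fun p => (machO p : Part (List Bool))) := by
  refine ⟨Computable.ofOption machO_primrec.to_comp, ?_⟩
  intro p q hp hq hpq
  have key : ∀ p, ((machO p : Part (List Bool))).Dom → p.idxOf false < p.length ∧
      (rst p).idxOf false < (rst p).length ∧
      (rst (rst p)).length = p.idxOf false * (rst p).idxOf false := by
    intro p hp
    by_contra h
    unfold machO at hp
    rw [if_neg h] at hp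
    exact hp
  obtain ⟨a1, a2, a3⟩ := key p hp
  obtain ⟨b1, b2, b3⟩ := key q hq
  obtain ⟨c1, c2, c3⟩ := rst_prefix hpq a1
  obtain ⟨d1, d2, d3⟩ := rst_prefix c2 a2
  exact c3 (d3 (d2.eq_of_length (by rw [a3, b3, c1, d1])))

theorem rst_unary (i : ℕ) (t : List Bool) :
    (List.replicate i true ++ false :: t).idxOf false = i ∧
    rst (List.replicate i true ++ false :: t) = t := by
  have h : (List.replicate i true ++ false :: t).idxOf false = i := by
    rw [List.idxOf_append_of_notMem (by simp)]; simp
  refine ⟨h, ?_⟩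
  unfold rst
  rw [h, List.drop_append]
  simp

theorem machO_apply (i k : ℕ) (t : List Bool) (ht : t.length = i * k) :
    machO (List.replicate i true ++ false :: (List.replicate k true ++ false :: t)) =
      some (t ++ List.replicate (k*k - i*k) false) := by
  unfold machO
  simp only [(rst_unary _ _).1, (rst_unary _ _).2]
  rw [if_pos]
  · simp [List.map_const']
  · simp [ht]

theorem pref_length (X : ℕ → Bool) (n : ℕ) : (pref X n).length = n := by simp [pref]

theorem pref_congr {X Y : ℕ → Bool} {n : ℕ} : pref X n = pref Y n ↔ ∀ i < n, X i = Y i := by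
  simp [pref]

theorem pref_zeros (X : ℕ → Bool) (a m : ℕ) (h : ∀ n, a ≤ n → n < a + m → X n = false) :
    pref X (a + m) = pref X a ++ List.replicate m false := by
  unfold pref
  rw [List.range_add, List.map_append, List.map_map]
  congr 1
  rw [List.eq_replicate_iff]
  refine ⟨by simp, ?_⟩
  intro b hb
  simp only [List.mem_map, List.mem_range, Function.comp] at hb
  obtain ⟨x, hx, rfl⟩ := hb
  exact h _ (by omega) (by omega)

theorem exists_mach_const (U : List Bool →. List Bool) (hU : UniversalPF U) :
    ∃ c : ℕ, ∀ i k : ℕ, ∀ t : List Bool, t.length = i * k →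
      ∃ q, (t ++ List.replicate (k*k - i*k) false) ∈ U q ∧ q.length ≤ i + k + 2 + i * k + c := by
  obtain ⟨c, hc⟩ := hU.2 _ machO_pf
  refine ⟨c, fun i k t ht => ?_⟩
  obtain ⟨q, hq, hl⟩ := hc (t ++ List.replicate (k*k - i*k) false) _
    (by rw [machO_apply i k t ht]; simp)
  refine ⟨q, hq, hl.trans ?_⟩
  simp [ht]; omega

theorem K_prog (U : List Bool →. List Bool) (hU : UniversalPF U) (w : List Bool) :
    ∃ p, w ∈ U p ∧ p.length = K U w := by
  have hne : {n : ℕ | ∃ p : List Bool, w ∈ U p ∧ p.length = n}.Nonempty := by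
    obtain ⟨c, hc⟩ := exists_mach_const U hU
    rcases Nat.eq_zero_or_pos w.length with h | h
    · obtain ⟨q, hq, _⟩ := hc 0 0 w (by simp [h])
      exact ⟨_, q, by simpa using hq, rfl⟩
    · obtain ⟨q, hq, _⟩ := hc w.length 1 w (by simp)
      have : 1 * 1 - w.length * 1 = 0 := by omega
      rw [this] at hq
      exact ⟨_, q, by simpa using hq, rfl⟩
  exact Nat.sInf_mem hne

theorem K_upper (U : List Bool →. List Bool) (hU : UniversalPF U) :
    ∃ c : ℕ, ∀ (X : Cantor) (i k : ℕ), i ≤ k → (∀ n, i * k ≤ n → n < k * k → X n = false) →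
      K U (pref X (k*k)) ≤ i + k + 2 + i * k + c := by
  obtain ⟨c, hc⟩ := exists_mach_const U hU
  refine ⟨c, fun X i k hik h => ?_⟩
  have hm : i * k ≤ k * k := Nat.mul_le_mul_right _ hik
  have := pref_zeros X (i*k) (k*k - i*k) (fun n h1 h2 => h n h1 (by omega))
  rw [show i * k + (k*k - i*k) = k*k by omega] at this
  obtain ⟨q, hq, hl⟩ := hc i k (pref X (i*k)) (pref_length _ _)
  rw [this]
  have hle : K U (pref X (i * k) ++ List.replicate (k*k - i*k) false) ≤ q.length :=
    Nat.sInf_le ⟨q, hq, rfl⟩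
  exact hle.trans hl

theorem isOpen_pref (Q : List Bool → Prop) (k : ℕ) : IsOpen {A : Cantor | Q (pref A k)} := by
  rw [isOpen_iff_mem_nhds]
  intro A hA
  refine Filter.mem_of_superset
    ((PiNat.isOpen_cylinder (fun _ : ℕ => Bool) A k).mem_nhds (PiNat.self_mem_cylinder A k)) ?_
  intro B hB
  have : pref B k = pref A k := pref_congr.2 hB
  simpa [this] using hA

theorem dense_of_ext (s : Set Cantor)
    (h : ∀ (X : Cantor) (l : ℕ), ∃ Y ∈ s, ∀ i < l, Y i = X i) : Dense s := by
  refine (PiNat.isTopologicalBasis_cylinders (fun _ : ℕ => Bool)).dense_iff.2 ?_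
  rintro o ⟨X, l, rfl⟩ -
  obtain ⟨Y, hY, hl⟩ := h X l
  exact ⟨Y, hl, hY⟩

theorem meagre_part (U : List Bool →. List Bool) (hU : UniversalPF U)
    (α : ℝ) (hα : 0 < α) : IsMeagre {X : Cantor | dimK U X = α} := by
  obtain ⟨c, hc⟩ := K_upper U hU
  have hG : ∀ N : ℕ, {X : Cantor | ∃ n, N ≤ n ∧ (K U (pref X n) : ℝ) / n < α / 2} ∈ residual Cantor := by
    intro N
    have ho : IsOpen {X : Cantor | ∃ n, N ≤ n ∧ (K U (pref X n) : ℝ) / n < α / 2} := by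
      have : {X : Cantor | ∃ n, N ≤ n ∧ (K U (pref X n) : ℝ) / n < α / 2} =
          ⋃ n, {X : Cantor | N ≤ n ∧ (K U (pref X n) : ℝ) / n < α / 2} := by
        ext; simp
      rw [this]
      exact isOpen_iUnion fun n => isOpen_pref (fun w => N ≤ n ∧ (K U w : ℝ) / n < α / 2) n
    refine residual_of_dense_open ho (dense_of_ext _ fun X l => ?_)
    let Y : Cantor := fun n => if n < l then X n else false
    refine ⟨Y, ?_, fun i hi => by simp [Y, hi]⟩
    obtain ⟨k, hk⟩ := exists_nat_gt (max (max (l:ℝ) N) (2 * (5 + c) / α))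
    have hk1 : l < k := by exact_mod_cast (le_max_left _ _).trans_lt ((le_max_left _ _).trans_lt hk)
    have hk2 : N < k := by exact_mod_cast (le_max_right _ _).trans_lt ((le_max_left _ _).trans_lt hk)
    have hk3 : 2 * (5 + c) / α < k := (le_max_right _ _).trans_lt hk
    have hb := hc Y 1 k (by omega) (fun n h1 h2 => by
      simp only [Y]; rw [if_neg]; omega)
    have hb' : (K U (pref Y (k*k)) : ℝ) ≤ 1 + k + 2 + 1 * k + c := by exact_mod_cast hb
    refine ⟨k * k, by nlinarith, ?_⟩
    have hk0 : (1:ℝ) ≤ k := by exact_mod_cast (by omega : 1 ≤ k)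
    rw [div_lt_iff₀ hα] at hk3
    push_cast
    rw [div_lt_iff₀ (by positivity)]
    have : (c:ℝ) ≤ c * k := by nlinarith [Nat.cast_nonneg (α := ℝ) c]
    nlinarith
  have hI := (countable_iInter_mem (l := residual Cantor)).2 hG
  refine Filter.mem_of_superset hI ?_
  intro X hX hd
  simp only [Set.mem_iInter, Set.mem_ofPred_eq] at hX hd
  unfold dimK at hd
  rw [Filter.liminf_eq] at hd
  have hlt : α / 2 < sSup {a : ℝ | ∀ᶠ n : ℕ in atTop, a ≤ (K U (pref X n) : ℝ) / n} := by
    rw [hd]; linarith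
  obtain ⟨a, ha, hlt⟩ := exists_lt_of_lt_csSup (s := {a : ℝ | ∀ᶠ n : ℕ in atTop, a ≤ (K U (pref X n) : ℝ) / n})
    ⟨0, by
      show ∀ᶠ n : ℕ in atTop, (0:ℝ) ≤ (K U (pref X n) : ℝ) / n
      exact Filter.Eventually.of_forall fun n => by positivity⟩ hlt
  obtain ⟨N, hN⟩ := Filter.eventually_atTop.1 ha
  obtain ⟨n, hn, hh⟩ := hX N
  linarith [hN n hn]

theorem liminf_eq_of (u : ℕ → ℝ) (α : ℝ)
    (h1 : ∀ ε > 0, ∀ᶠ n in atTop, α - ε ≤ u n)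
    (h2 : ∀ ε > 0, ∃ᶠ n in atTop, u n ≤ α + ε) : liminf u atTop = α := by
  rw [Filter.liminf_eq]
  apply IsLUB.csSup_eq _ ⟨α - 1, h1 1 one_pos⟩
  constructor
  · intro a ha
    refine le_of_forall_pos_le_add fun ε hε => ?_
    obtain ⟨n, hn, hn'⟩ := ((h2 ε hε).and_eventually ha).exists
    linarith
  · intro b hb
    refine le_of_forall_pos_le_add fun ε hε => ?_
    have := hb (h1 ε hε)
    linarith

theorem not_pi_of_dense (s : Set Cantor) (hm : IsMeagre s) (hd : Dense s) :
    ¬ PiIn 2 DeltaPred s := by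
  rintro ⟨P, -, hP⟩
  have hs : s = ⋂ k : ℕ, ⋃ j : ℕ, {A : Cantor | P [k] (pref A j)} := by
    ext A
    rw [hP]
    simp [AltQ]
  have hr : s ∈ residual Cantor := by
    have ho : ∀ k : ℕ, IsOpen (⋃ j : ℕ, {A : Cantor | P [k] (pref A j)}) :=
      fun k => isOpen_iUnion fun j => isOpen_pref (P [k]) j
    have hmem : (⋂ k : ℕ, ⋃ j : ℕ, {A : Cantor | P [k] (pref A j)}) ∈ residual Cantor := by
      refine (countable_iInter_mem (l := residual Cantor)).2 fun k => ?_
      refine residual_of_dense_open (ho k) (hd.mono ?_)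
      rw [hs]
      exact Set.iInter_subset _ k
    rwa [← hs] at hmem
  have he : (∅ : Set Cantor) ∈ residual Cantor := by
    have := Filter.inter_mem hr hm
    simpa using this
  have := dense_of_mem_residual he
  simpa using this.nonempty


theorem sum_two_pow_le (m : ℕ) : ∑ l ∈ Finset.range m, 2 ^ l ≤ 2 ^ m := by
  induction m with
  | zero => simp
  | succ m ih => rw [Finset.sum_range_succ, pow_succ]; omega

open Classical in
theorem random_lemma (U : List Bool →. List Bool) (hU : UniversalPF U) (σ : Cantor)
    (T : ℕ → Prop) :
    ∃ X : Cantor, (∀ n, ¬ T n → X n = σ n) ∧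
      ∀ᶠ n in atTop, ((Finset.range n).filter T).card ≤ K U (pref X n) + 2 * n.size := by
  let Φ : Cantor → Cantor := fun Y n => if T n then Y n else σ n
  let F : ℕ → Finset ℕ := fun n => (Finset.range n).filter T
  let μ : MeasureTheory.Measure Cantor :=
    MeasureTheory.Measure.infinitePi fun _ : ℕ => (PMF.uniformOfFintype Bool).toMeasure
  let bad : ℕ → Set Cantor := fun n => {Y | K U (pref (Φ Y) n) + 2 * n.size < (F n).card}
  have hcyl : ∀ n p, μ {Y | pref (Φ Y) n ∈ U p} ≤ (2⁻¹ : ENNReal) ^ (F n).card := by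
    intro n p
    rcases Set.eq_empty_or_nonempty {Y | pref (Φ Y) n ∈ U p} with h | ⟨Y0, h0⟩
    · rw [h]; simp
    · have hsub : {Y | pref (Φ Y) n ∈ U p} ⊆ Set.pi (F n : Set ℕ) (fun i => {Y0 i}) := by
        intro Y hY i hi
        have he : pref (Φ Y) n = pref (Φ Y0) n := Part.mem_unique hY h0
        have hi' : i < n ∧ T i := by simpa [F] using hi
        have := pref_congr.1 he i hi'.1
        simpa [Φ, hi'.2] using this
      refine (MeasureTheory.measure_mono hsub).trans ?_
      rw [MeasureTheory.Measure.infinitePi_pi _ (fun i _ => measurableSet_singleton _)]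
      simp [PMF.toMeasure_apply_singleton]
  have hbad : ∀ n, μ (bad n) ≤ (2⁻¹ : ENNReal) ^ (2 * n.size) := by
    intro n
    by_cases hlt : 2 * n.size < (F n).card
    · set m := (F n).card - 2 * n.size with hm
      have hsub : bad n ⊆ ⋃ l ∈ Finset.range m, ⋃ v : Fin l → Bool,
          {Y | pref (Φ Y) n ∈ U (List.ofFn v)} := by
        intro Y hY
        have hY' : K U (pref (Φ Y) n) + 2 * n.size < (F n).card := hY
        obtain ⟨p, hp, hl⟩ := K_prog U hU (pref (Φ Y) n)
        simp only [Set.mem_iUnion]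
        refine ⟨p.length, by simp; omega, p.get, ?_⟩
        show pref (Φ Y) n ∈ U (List.ofFn p.get)
        rw [List.ofFn_get]
        exact hp
      calc μ (bad n) ≤ _ := MeasureTheory.measure_mono hsub
        _ ≤ ∑ l ∈ Finset.range m, μ (⋃ v : Fin l → Bool,
          {Y | pref (Φ Y) n ∈ U (List.ofFn v)}) := MeasureTheory.measure_biUnion_finset_le _ _
        _ ≤ ∑ l ∈ Finset.range m, ((2 ^ l : ℕ) : ENNReal) * (2⁻¹ : ENNReal) ^ (F n).card := by
          refine Finset.sum_le_sum fun l _ => ?_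
          refine (MeasureTheory.measure_iUnion_fintype_le _ _).trans ?_
          refine (Finset.sum_le_sum fun v _ => hcyl n _).trans ?_
          simp
        _ = ((∑ l ∈ Finset.range m, 2 ^ l : ℕ) : ENNReal) * (2⁻¹ : ENNReal) ^ (F n).card := by
          rw [← Finset.sum_mul]; push_cast; rfl
        _ ≤ ((2 ^ m : ℕ) : ENNReal) * (2⁻¹ : ENNReal) ^ (F n).card := by
          gcongr; exact sum_two_pow_le m
        _ = (2⁻¹ : ENNReal) ^ (2 * n.size) := by
          have : (F n).card = m + 2 * n.size := by omega
          rw [this, pow_add, ← mul_assoc]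
          push_cast
          rw [← mul_pow, ENNReal.mul_inv_cancel (by simp) (by simp)]
          simp
    · have : bad n = ∅ := by
        ext Y
        simp only [bad, Set.mem_ofPred_eq, Set.mem_empty_iff_false, iff_false]
        omega
      rw [this]; simp
  have hsum : ∑' n, μ (bad n) ≠ ⊤ := by
    have hs : Summable (fun n : ℕ => (2⁻¹ : ℝ) ^ (2 * n.size)) := by
      refine Summable.of_nonneg_of_le (fun n => by positivity) (fun n => ?_)
        ((summable_nat_add_iff 1).2 (Real.summable_one_div_nat_pow.2 (by norm_num : 1 < 2)))
      have h1 : n + 1 ≤ 2 ^ n.size := Nat.lt_size_self n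
      have h2 : ((n + 1 : ℕ) : ℝ) ≤ 2 ^ n.size := by exact_mod_cast h1
      rw [mul_comm, pow_mul, inv_pow, inv_pow, ← one_div]
      gcongr
    refine ne_top_of_le_ne_top hs.tsum_ofReal_ne_top (ENNReal.tsum_le_tsum fun n => ?_)
    refine (hbad n).trans (le_of_eq ?_)
    rw [ENNReal.ofReal_pow (by norm_num), ENNReal.ofReal_inv_of_pos (by norm_num)]
    simp
  have h0 := MeasureTheory.ae_eventually_notMem hsum
  obtain ⟨Y, hY⟩ := h0.exists
  refine ⟨Φ Y, fun n hn => by simp [Φ, hn], hY.mono fun n hn => ?_⟩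
  simp only [bad, Set.mem_ofPred_eq, not_lt] at hn
  exact hn

theorem size_sq (n : ℕ) (hn : 0 < n) : n.size ^ 2 ≤ 4 * n := by
  have h1 : 0 < n.size := Nat.size_pos.2 hn
  obtain ⟨s, hs⟩ : ∃ s, n.size = s + 1 := ⟨n.size - 1, by omega⟩
  have h2 : 2 ^ s ≤ n := Nat.lt_size.1 (by omega)
  rw [hs]
  have h3 : ∀ s : ℕ, (s + 1) ^ 2 ≤ 4 * 2 ^ s := by
    intro s
    induction s with
    | zero => norm_num
    | succ s ih =>
      rcases Nat.lt_or_ge s 2 with h | h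
      · interval_cases s <;> norm_num
      · rw [pow_succ 2 s]; nlinarith
  exact (h3 s).trans (by omega)

theorem size_small (ε : ℝ) (hε : 0 < ε) : ∀ᶠ n : ℕ in atTop, 2 * (n.size : ℝ) ≤ ε * n := by
  filter_upwards [eventually_ge_atTop (⌈16 / ε ^ 2⌉₊), eventually_gt_atTop 0] with n hn hn0
  have h1 : 16 / ε ^ 2 ≤ n := (Nat.le_ceil _).trans (by exact_mod_cast hn)
  have h2 : (n.size : ℝ) ^ 2 ≤ 4 * n := by exact_mod_cast size_sq n hn0
  rw [div_le_iff₀ (by positivity)] at h1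
  have hn' : (0:ℝ) < n := by exact_mod_cast hn0
  refine (pow_le_pow_iff_left₀ (by positivity) (by positivity) two_ne_zero).1 ?_
  nlinarith


/-- Stage parameter. -/
def kk (j : ℕ) : ℕ := (j + 1).factorial
/-- Total length at the end of stage `j`. -/
def LL (j : ℕ) : ℕ := kk j * kk j
/-- Number of unary blocks. -/
noncomputable def ii (α : ℝ) (j : ℕ) : ℕ := ⌈α * kk j⌉₊
/-- Beginning of the zero block of stage `j`. -/
noncomputable def aa (α : ℝ) (j : ℕ) : ℕ := ii α j * kk j

theorem kk_pos (j : ℕ) : 0 < kk j := Nat.factorial_pos _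
theorem kk_mono : Monotone kk := fun _ _ h => Nat.factorial_le (by omega)
theorem kk_ge (j : ℕ) : j + 1 ≤ kk j := Nat.self_le_factorial _
theorem LL_mono : Monotone LL := fun _ _ h => Nat.mul_le_mul (kk_mono h) (kk_mono h)
theorem LL_succ (j : ℕ) : LL (j + 1) = (j + 2) ^ 2 * LL j := by
  simp only [LL, kk, Nat.factorial_succ (j + 1)]; ring
theorem aa_mono (α : ℝ) (hα : 0 < α) : Monotone (aa α) := fun i j h => by
  have h1 := kk_mono h
  refine Nat.mul_le_mul (Nat.ceil_mono ?_) h1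
  have : (kk i : ℝ) ≤ kk j := by exact_mod_cast h1
  gcongr
theorem aa_ge (α : ℝ) (j : ℕ) : α * LL j ≤ aa α j := by
  simp only [aa, LL, ii]
  push_cast
  rw [← mul_assoc]
  gcongr
  exact Nat.le_ceil _
theorem ii_le (α : ℝ) (hα : α ≤ 1) (j : ℕ) : ii α j ≤ kk j := by
  apply Nat.ceil_le.2
  have : (0:ℝ) ≤ kk j := by positivity
  nlinarith
theorem aa_unbounded (α : ℝ) (hα : 0 < α) (j : ℕ) : j + 1 ≤ aa α j := by
  have h1 : 1 ≤ ii α j := by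
    apply Nat.ceil_pos.2
    have : (0:ℝ) < kk j := by exact_mod_cast kk_pos j
    positivity
  have := kk_ge j
  simp only [aa]; nlinarith

open Classical in
theorem count_lower (α : ℝ) (hα : 0 < α) (hα1 : α ≤ 1) (l : ℕ) (ε : ℝ) (hε : 0 < ε) :
    ∀ᶠ n : ℕ in atTop, (α - 2 * ε) * n ≤ (((Finset.range n).filter
      (fun n => l ≤ n ∧ ¬ ∃ j, aa α j ≤ n ∧ n < LL j)).card : ℝ) := by
  obtain ⟨J, hJ⟩ := exists_nat_gt (1 / (ε * α))
  rw [div_lt_iff₀ (by positivity)] at hJ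
  filter_upwards [eventually_gt_atTop (aa α (J + 1)), eventually_ge_atTop (⌈l / ε⌉₊)] with n hn hl
  have hl' : (l : ℝ) ≤ ε * n := by
    have : (l : ℝ) / ε ≤ n := (Nat.le_ceil _).trans (by exact_mod_cast hl)
    rw [div_le_iff₀ hε] at this
    linarith
  have hex : ∃ j, n ≤ aa α j := ⟨n, by have := aa_unbounded α hα n; omega⟩
  obtain ⟨j, hj1, hj2, hj3⟩ : ∃ j, J ≤ j ∧ aa α (j + 1) < n ∧ n ≤ aa α (j + 2) := by
    have h1 := Nat.find_spec hex
    have h2 : ∀ i ≤ J + 1, i < Nat.find hex := by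
      intro i hi
      by_contra h
      have := aa_mono α hα ((not_lt.1 h).trans hi)
      omega
    have h3 := h2 (J + 1) le_rfl
    refine ⟨Nat.find hex - 2, by omega, ?_, ?_⟩
    · exact not_le.1 (Nat.find_min hex (by omega))
    · rwa [show Nat.find hex - 2 + 2 = Nat.find hex by omega]
  set T : ℕ → Prop := fun n => l ≤ n ∧ ¬ ∃ j, aa α j ≤ n ∧ n < LL j with hT
  have hsub : (Finset.range n).filter (fun x => ¬ T x) ⊆
      Finset.range l ∪ (Finset.range (LL j) ∪ Finset.Ico (aa α (j + 1)) (min n (LL (j + 1)))) := by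
    intro x hx
    simp only [Finset.mem_filter, Finset.mem_range, hT, not_and, not_not] at hx
    simp only [Finset.mem_union, Finset.mem_range, Finset.mem_Ico, lt_min_iff]
    by_cases hxl : x < l
    · exact Or.inl hxl
    · right
      obtain ⟨i, hi1, hi2⟩ := hx.2 (by omega)
      rcases lt_trichotomy i (j + 1) with h | h | h
      · left; exact hi2.trans_le (LL_mono (by omega))
      · subst h; right; exact ⟨hi1, hx.1, hi2⟩
      · have := aa_mono α hα (show j + 2 ≤ i by omega)
        omega
  have hcard := Finset.card_le_card hsub
  have hc2 := hcard.trans ((Finset.card_union_le _ _).trans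
    (Nat.add_le_add_left (Finset.card_union_le _ _) _))
  simp only [Finset.card_range, Nat.card_Ico] at hc2
  have hpart := Finset.card_filter_add_card_filter_not (s := Finset.range n) T
  rw [Finset.card_range] at hpart
  have hLj : (LL j : ℝ) ≤ ε * n := by
    have h1 : ((j : ℝ) + 2) ^ 2 * LL j = LL (j + 1) := by rw [LL_succ]; push_cast; ring
    have h2 := aa_ge α (j + 1)
    have h3 : (aa α (j + 1) : ℝ) ≤ n := by exact_mod_cast hj2.le
    have h4 : (J : ℝ) ≤ j := by exact_mod_cast hj1
    have h5 : (0:ℝ) ≤ LL j := by positivity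
    have h6 : (1:ℝ) ≤ ε * α * ((j:ℝ) + 2) ^ 2 := by
      have : (0:ℝ) < ε * α := by positivity
      have hj0 : (0:ℝ) ≤ j := by positivity
      have h7 : (j:ℝ) ≤ ((j:ℝ) + 2) ^ 2 := by nlinarith
      nlinarith
    calc (LL j : ℝ) ≤ (ε * α * ((j:ℝ) + 2) ^ 2) * LL j := le_mul_of_one_le_left h5 h6
      _ = ε * (α * LL (j + 1)) := by rw [← h1]; ring
      _ ≤ ε * n := by gcongr; linarith
  have hI : ((min n (LL (j + 1)) - aa α (j + 1) : ℕ) : ℝ) ≤ (1 - α) * n := by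
    have hn0 : (0:ℝ) ≤ n := by positivity
    rcases le_total (aa α (j + 1)) (min n (LL (j + 1))) with h | h
    · rw [Nat.cast_sub h]
      have h2 := aa_ge α (j + 1)
      have h3 : ((min n (LL (j + 1)) : ℕ) : ℝ) ≤ n := by exact_mod_cast min_le_left _ _
      have h4 : ((min n (LL (j + 1)) : ℕ) : ℝ) ≤ LL (j + 1) := by exact_mod_cast min_le_right _ _
      nlinarith
    · rw [Nat.sub_eq_zero_of_le h]
      have : 0 ≤ 1 - α := by linarith
      push_cast; positivity
  have hc3 : (((Finset.range n).filter (fun x => ¬ T x)).card : ℝ) ≤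
      l + (LL j + ((min n (LL (j + 1)) - aa α (j + 1) : ℕ) : ℝ)) := by exact_mod_cast hc2
  have hp3 : (((Finset.range n).filter T).card : ℝ) +
      ((Finset.range n).filter (fun x => ¬ T x)).card = n := by exact_mod_cast hpart
  have : (α - 2 * ε) * n ≤ (((Finset.range n).filter T).card : ℝ) := by linarith
  exact this

theorem exists_dim (U : List Bool →. List Bool) (hU : UniversalPF U)
    (α : ℝ) (hα : 0 < α) (hα1 : α ≤ 1) (X0 : Cantor) (l : ℕ) :
    ∃ Y ∈ {X : Cantor | dimK U X = α}, ∀ i < l, Y i = X0 i := by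
  classical
  obtain ⟨X, hX, hK⟩ := random_lemma U hU (fun n => if n < l then X0 n else false)
    (fun n => l ≤ n ∧ ¬ ∃ j, aa α j ≤ n ∧ n < LL j)
  refine ⟨X, ?_, fun i hi => by rw [hX i (by omega), if_pos hi]⟩
  show dimK U X = α
  refine liminf_eq_of _ _ ?_ ?_
  · intro ε hε
    filter_upwards [hK, count_lower α hα hα1 l (ε / 4) (by positivity),
      size_small (ε / 4) (by positivity), eventually_gt_atTop 0] with n h1 h2 h3 h4
    have hn : (0:ℝ) < n := by exact_mod_cast h4
    rw [le_div_iff₀ hn]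
    have h1' : (α - 2 * (ε / 4)) * n ≤ ((K U (pref X n) + 2 * n.size : ℕ) : ℝ) := by
      refine h2.trans (Nat.cast_le.2 ?_)
      convert h1
    push_cast at h1'
    nlinarith
  · intro ε hε
    obtain ⟨c, hc⟩ := K_upper U hU
    rw [Filter.frequently_atTop]
    intro N
    obtain ⟨j, hj⟩ := exists_nat_gt (max (max (l:ℝ) N) ((5 + c) / ε))
    have hj1 : l < j := by exact_mod_cast (le_max_left _ _).trans_lt ((le_max_left _ _).trans_lt hj)
    have hj2 : N < j := by exact_mod_cast (le_max_right _ _).trans_lt ((le_max_left _ _).trans_lt hj)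
    have hj3 : (5 + c) / ε < j := (le_max_right _ _).trans_lt hj
    rw [div_lt_iff₀ hε] at hj3
    have hkj := kk_ge j
    refine ⟨LL j, by simp only [LL, ge_iff_le]; nlinarith, ?_⟩
    have haj := aa_unbounded α hα j
    have hb := hc X (ii α j) (kk j) (ii_le α hα1 j) (fun n h1 h2 => by
      have hz : ∃ j, aa α j ≤ n ∧ n < LL j := ⟨j, h1, h2⟩
      rw [hX n (fun h => h.2 hz), if_neg]
      simp only [aa] at haj
      omega)
    have hi1 : (ii α j : ℝ) ≤ α * kk j + 1 := (Nat.ceil_lt_add_one (by positivity)).le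
    have hi2 : (ii α j : ℝ) ≤ kk j := by exact_mod_cast ii_le α hα1 j
    have hb' : (K U (pref X (LL j)) : ℝ) ≤ ii α j + kk j + 2 + ii α j * kk j + c := by
      exact_mod_cast hb
    have hk1 : (1:ℝ) ≤ kk j := by exact_mod_cast kk_pos j
    have hk2 : (j:ℝ) ≤ kk j := by exact_mod_cast (by omega : j ≤ kk j)
    have hLL : (LL j : ℝ) = kk j * kk j := by simp [LL]
    rw [hLL, div_le_iff₀ (by positivity)]
    have e1 : (ii α j : ℝ) * kk j ≤ (α * kk j + 1) * kk j := by gcongr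
    have e2 : (5 + c : ℝ) ≤ kk j * ε := hj3.le.trans (by gcongr)
    have e3 : (5 + c : ℝ) * kk j ≤ kk j * ε * kk j := by gcongr
    have e4 : (c:ℝ) ≤ c * kk j := le_mul_of_one_le_right (by positivity) hk1
    nlinarith

/-- For every `α ∈ (0,1]`, the class `DIM^α = {X | dim(X) = α}` is meager in
Cantor space, and therefore not a Π⁰₂ class. -/
theorem DIM_meager_not_Pi02 (U : List Bool →. List Bool) (hU : UniversalPF U)
    (α : ℝ) (hα : α ∈ Set.Ioc (0:ℝ) 1) :
    IsMeagre {X : Cantor | dimK U X = α} ∧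
    ¬ PiIn 2 DeltaPred {X : Cantor | dimK U X = α} := by
  have hm := meagre_part U hU α hα.1
  exact ⟨hm, not_pi_of_dense _ hm (dense_of_ext _ (exists_dim U hU α hα.1 hα.2))⟩
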